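/- arXiv:2102.10261 — 2 statements merged into one kernel-verified Lean document; each statement's English description precedes it below -/
import Mathlib

section
/- In the rounding process with LP-feasible x: if edge (i,t) is early, then P[(i,t) ∈ M₁] = x_{i,t}·(1/2 + c); moreover, for every edge (i,t) (early or late), x_{i,t}·(1/2 − 3c) ≤ P[(i,t) ∈ M₁] ≤ x_{i,t}·(1/2 + c). -/
open Finset

noncomputable section
open scoped Classical

namespace Rounding

/-- A configuration of all the randomness used by the rounding process: arrival
indicators `A_t`, first picks `I¹_t`, second picks `I²_t`, and acceptance coins
`Y_{i,t}`. -/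
abbrev Cfg (m n : ℕ) :=
  (Fin n → Bool) × (Fin n → Fin m) × (Fin n → Fin m) × (Fin m → Fin n → Bool)

/-- The constant `c = 1/100`. -/
def c : ℝ := 1 / 100

variable (m n : ℕ)

/-- `S x i t = ∑_{t' < t} x i t'`. -/
def S (x : Fin m → Fin n → ℝ) (i : Fin m) (t : Fin n) : ℝ :=
  ∑ t' ∈ Finset.univ.filter fun t' : Fin n => t' < t, x i t'

/-- LP-feasibility of `x` (with arrival probabilities `p t ∈ (0,1]`, every
constraint `∑_i x i t = p t` tight). -/
def LPFeasible (p : Fin n → ℝ) (x : Fin m → Fin n → ℝ) : Prop :=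
  (∀ t, 0 < p t ∧ p t ≤ 1) ∧
  (∀ i t, 0 ≤ x i t) ∧
  (∀ i, ∑ t, x i t ≤ 1) ∧
  (∀ t, ∑ i, x i t = p t) ∧
  (∀ i t, x i t ≤ p t * (1 - S m n x i t))

/-- Edge `(i,t)` is early if `∑_{t' < t} x i t' ≤ (1/2 − c)/(1/2 + c)`. -/
def Early (x : Fin m → Fin n → ℝ) (i : Fin m) (t : Fin n) : Prop :=
  S m n x i t ≤ (1/2 - c) / (1/2 + c)

/-- Edge `(i,t)` is late if it is not early. -/
def Late (x : Fin m → Fin n → ℝ) (i : Fin m) (t : Fin n) : Prop :=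
  ¬ Early m n x i t

/-- The acceptance probability `q_{i,t}`. -/
def q (x : Fin m → Fin n → ℝ) (i : Fin m) (t : Fin n) : ℝ :=
  min 1 ((1/2 + c) / (1 - (1/2 + c) * S m n x i t))

/-- The probability of a configuration: the product of the probabilities of all
the mutually independent components (`P(A_t = 1) = p_t`,
`P(I¹_t = i) = P(I²_t = i) = x_{i,t}/p_t`, `P(Y_{i,t} = 1) = q_{i,t}`). -/
def weight (p : Fin n → ℝ) (x : Fin m → Fin n → ℝ) (cfg : Cfg m n) : ℝ :=
  (∏ t, if cfg.1 t then p t else 1 - p t) *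
  (∏ t, x (cfg.2.1 t) t / p t) *
  (∏ t, x (cfg.2.2.1 t) t / p t) *
  ∏ i, ∏ t, if cfg.2.2.2 i t then q m n x i t else 1 - q m n x i t

/-- Probability of an event. -/
def Pr (p : Fin n → ℝ) (x : Fin m → Fin n → ℝ) (E : Set (Cfg m n)) : ℝ :=
  ∑ cfg : Cfg m n, if cfg ∈ E then weight m n p x cfg else 0

/-- Conditional probability of `E` given `F`. -/
def condPr (p : Fin n → ℝ) (x : Fin m → Fin n → ℝ) (E F : Set (Cfg m n)) : ℝ :=
  Pr m n p x (E ∩ F) / Pr m n p x F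

/-- Bin `i` is unmatched in the partial matching `M`. -/
def FreeBin (M : Finset (Fin m × Fin n)) (i : Fin m) : Prop :=
  ∀ t, (i, t) ∉ M

/-- `proc x cfg t = (M₁, M₂)`: the two parts of the matching built by the rounding
process after processing all times `< t`.  At each time `t`, if ball `t` arrives,
its first pick `I¹_t` is unmatched, and the coin `Y_{I¹_t,t}` comes up heads, then
`(I¹_t, t)` is added to `M₁`; otherwise, if ball `t` arrives, its second pick
`I²_t` is unmatched, and edge `(I²_t, t)` is late, then `(I²_t, t)` is added
to `M₂`. -/
def proc (x : Fin m → Fin n → ℝ) (cfg : Cfg m n) :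
    ℕ → Finset (Fin m × Fin n) × Finset (Fin m × Fin n)
  | 0 => (∅, ∅)
  | (t + 1) =>
    let P := proc x cfg t
    if h : t < n then
      let T : Fin n := ⟨t, h⟩
      let M := P.1 ∪ P.2
      if cfg.1 T = true ∧ FreeBin m n M (cfg.2.1 T) ∧ cfg.2.2.2 (cfg.2.1 T) T = true then
        (insert (cfg.2.1 T, T) P.1, P.2)
      else if cfg.1 T = true ∧ FreeBin m n M (cfg.2.2.1 T) ∧ Late m n x (cfg.2.2.1 T) T then
        (P.1, insert (cfg.2.2.1 T, T) P.2)
      else P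
    else P

/-- The final matching `M₁` (edges matched on a first pick). -/
def M1F (x : Fin m → Fin n → ℝ) (cfg : Cfg m n) : Finset (Fin m × Fin n) :=
  (proc m n x cfg n).1

/-- The final matching `M₂` (edges matched on a second pick). -/
def M2F (x : Fin m → Fin n → ℝ) (cfg : Cfg m n) : Finset (Fin m × Fin n) :=
  (proc m n x cfg n).2

/-- The final matching `M = M₁ ∪ M₂`. -/
def MF (x : Fin m → Fin n → ℝ) (cfg : Cfg m n) : Finset (Fin m × Fin n) :=
  M1F m n x cfg ∪ M2F m n x cfg

/-- `V_{i,t}`: the event that bin `i` is unmatched before time `t`. -/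
def V (x : Fin m → Fin n → ℝ) (i : Fin m) (t : Fin n) : Set (Cfg m n) :=
  {cfg | FreeBin m n ((proc m n x cfg t.1).1 ∪ (proc m n x cfg t.1).2) i}

/-- `O_{i,t}`: the event that bin `i` is matched before time `t`. -/
def O (x : Fin m → Fin n → ℝ) (i : Fin m) (t : Fin n) : Set (Cfg m n) :=
  (V m n x i t)ᶜ

/-- `O^E_{i,t}`: the event that bin `i` is matched along an early edge before time `t`. -/
def OE (x : Fin m → Fin n → ℝ) (i : Fin m) (t : Fin n) : Set (Cfg m n) :=
  {cfg | ∃ t' : Fin n, Early m n x i t' ∧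
    (i, t') ∈ (proc m n x cfg t.1).1 ∪ (proc m n x cfg t.1).2}

/-- `O^L_{i,t}`: the event that bin `i` is matched along a late edge before time `t`. -/
def OL (x : Fin m → Fin n → ℝ) (i : Fin m) (t : Fin n) : Set (Cfg m n) :=
  {cfg | ∃ t' : Fin n, Late m n x i t' ∧
    (i, t') ∈ (proc m n x cfg t.1).1 ∪ (proc m n x cfg t.1).2}

/-- `U₁(t)`: the event that ball `t` is not matched in the first-pick step at time `t`. -/
def U1 (x : Fin m → Fin n → ℝ) (t : Fin n) : Set (Cfg m n) :=
  {cfg | ∀ i, (i, t) ∉ (proc m n x cfg (t.1 + 1)).1}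

/-- The event that ball `t` arrives (`A_t = 1`). -/
def EvA (t : Fin n) : Set (Cfg m n) := {cfg | cfg.1 t = true}

/-- The event that the first pick of ball `t` is bin `j` (`I¹_t = j`). -/
def EvI1 (j : Fin m) (t : Fin n) : Set (Cfg m n) := {cfg | cfg.2.1 t = j}


section
variable {m n}

/-- The randomness attached to a single ball. -/
abbrev Slot (m : ℕ) := Bool × Fin m × Fin m × (Fin m → Bool)

/-- The part of a configuration used when ball `t` is processed. -/
def slot (cfg : Cfg m n) (t : Fin n) : Slot m :=
  (cfg.1 t, cfg.2.1 t, cfg.2.2.1 t, fun i => cfg.2.2.2 i t)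

/-- Replace the randomness attached to ball `t`. -/
def updateSlot (cfg : Cfg m n) (t : Fin n) (b : Slot m) : Cfg m n :=
  (Function.update cfg.1 t b.1, Function.update cfg.2.1 t b.2.1,
    Function.update cfg.2.2.1 t b.2.2.1,
    fun i => Function.update (cfg.2.2.2 i) t (b.2.2.2 i))

/-- The law of the randomness attached to ball `t`. -/
def slotWeight (p : Fin n → ℝ) (x : Fin m → Fin n → ℝ) (t : Fin n) (b : Slot m) : ℝ :=
  (if b.1 then p t else 1 - p t) * (x b.2.1 t / p t) * (x b.2.2.1 t / p t) *
    ∏ i, if b.2.2.2 i then q m n x i t else 1 - q m n x i t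

lemma slot_updateSlot_self (cfg : Cfg m n) (t : Fin n) (b : Slot m) :
    slot (updateSlot cfg t b) t = b := by
  simp [slot, updateSlot]

lemma slot_updateSlot_of_ne (cfg : Cfg m n) {s t : Fin n} (h : s ≠ t) (b : Slot m) :
    slot (updateSlot cfg t b) s = slot cfg s := by
  simp [slot, updateSlot, Function.update_of_ne h]

lemma updateSlot_updateSlot_slot (cfg : Cfg m n) (t : Fin n) (b : Slot m) :
    updateSlot (updateSlot cfg t b) t (slot cfg t) = cfg := by
  simp [slot, updateSlot]

lemma weight_eq_prod_slotWeight (p : Fin n → ℝ) (x : Fin m → Fin n → ℝ) (cfg : Cfg m n) :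
    weight m n p x cfg = ∏ t, slotWeight p x t (slot cfg t) := by
  simp only [weight, slotWeight, slot, Finset.prod_mul_distrib]
  congr 1
  exact Finset.prod_comm

lemma weight_updateSlot_mul (p : Fin n → ℝ) (x : Fin m → Fin n → ℝ) (cfg : Cfg m n)
    (t : Fin n) (b : Slot m) :
    weight m n p x (updateSlot cfg t b) * slotWeight p x t (slot cfg t) =
      weight m n p x cfg * slotWeight p x t b := by
  have h : ∏ s ∈ Finset.univ.erase t, slotWeight p x s (slot (updateSlot cfg t b) s) =
      ∏ s ∈ Finset.univ.erase t, slotWeight p x s (slot cfg s) :=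
    Finset.prod_congr rfl fun s hs => by
      rw [slot_updateSlot_of_ne cfg (Finset.ne_of_mem_erase hs)]
  rw [weight_eq_prod_slotWeight, weight_eq_prod_slotWeight,
    ← Finset.mul_prod_erase _ _ (Finset.mem_univ t),
    ← Finset.mul_prod_erase _ (fun s => slotWeight p x s (slot cfg s)) (Finset.mem_univ t), h,
    slot_updateSlot_self]
  ring

lemma sum_prod_mul {α β : Type*} [Fintype α] [Fintype β] (f : α → ℝ) (g : β → ℝ) :
    ∑ z : α × β, f z.1 * g z.2 = (∑ a, f a) * ∑ b, g b := by
  rw [Fintype.sum_prod_type, Finset.sum_mul_sum]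

lemma sum_prod_mul_four {α β γ δ : Type*} [Fintype α] [Fintype β] [Fintype γ] [Fintype δ]
    (f : α → ℝ) (g : β → ℝ) (h : γ → ℝ) (k : δ → ℝ) :
    ∑ z : α × β × γ × δ, f z.1 * g z.2.1 * h z.2.2.1 * k z.2.2.2 =
      (∑ a, f a) * (∑ b, g b) * (∑ c, h c) * ∑ d, k d := by
  simp only [mul_assoc]
  rw [sum_prod_mul f (fun z : β × γ × δ => g z.1 * (h z.2.1 * k z.2.2)),
    sum_prod_mul g (fun z : γ × δ => h z.1 * k z.2), sum_prod_mul]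

lemma sum_slotWeight_mul (p : Fin n → ℝ) (x : Fin m → Fin n → ℝ) (t : Fin n)
    (f : Bool → ℝ) (g h : Fin m → ℝ) (k : Fin m → Bool → ℝ) :
    ∑ b : Slot m, slotWeight p x t b *
        (f b.1 * g b.2.1 * h b.2.2.1 * ∏ i, k i (b.2.2.2 i)) =
      (p t * f true + (1 - p t) * f false) * (∑ i, x i t / p t * g i) *
        (∑ i, x i t / p t * h i) *
        ∏ i, (q m n x i t * k i true + (1 - q m n x i t) * k i false) := by
  have hk : ∏ i, (q m n x i t * k i true + (1 - q m n x i t) * k i false) =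
      ∑ y : Fin m → Bool, ∏ i, (if y i then q m n x i t else 1 - q m n x i t) * k i (y i) := by
    have := Finset.prod_univ_sum (fun _ : Fin m => (Finset.univ : Finset Bool))
      (fun i b => (if b then q m n x i t else 1 - q m n x i t) * k i b)
    rw [Fintype.piFinset_univ] at this
    simpa using this
  have hf : p t * f true + (1 - p t) * f false =
      ∑ a : Bool, (if a then p t else 1 - p t) * f a := by simp
  rw [hk, hf]
  rw [← sum_prod_mul_four (fun a : Bool => (if a then p t else 1 - p t) * f a)
    (fun j => x j t / p t * g j) (fun j => x j t / p t * h j)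
    (fun y : Fin m → Bool => ∏ i, (if y i then q m n x i t else 1 - q m n x i t) * k i (y i))]
  refine Finset.sum_congr rfl fun b _ => ?_
  rw [slotWeight, Finset.prod_mul_distrib]
  ring

/-- A factor that ignores the randomness of ball `t` is independent of that randomness. -/
lemma sum_weight_mul_slot (p : Fin n → ℝ) (x : Fin m → Fin n → ℝ) (t : Fin n)
    (hw : ∑ b, slotWeight p x t b = 1) (g : Cfg m n → ℝ)
    (hg : ∀ cfg b, g (updateSlot cfg t b) = g cfg) (h : Slot m → ℝ) :
    ∑ cfg, weight m n p x cfg * g cfg * h (slot cfg t) =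
      (∑ cfg, weight m n p x cfg * g cfg) * ∑ b, slotWeight p x t b * h b := by
  let e : Cfg m n × Slot m → Cfg m n × Slot m := fun z => (updateSlot z.1 t z.2, slot z.1 t)
  have he : Function.Involutive e := fun z => by
    simp only [e, updateSlot_updateSlot_slot, slot_updateSlot_self]
  calc ∑ cfg, weight m n p x cfg * g cfg * h (slot cfg t)
      = ∑ z : Cfg m n × Slot m,
          weight m n p x z.1 * g z.1 * h (slot z.1 t) * slotWeight p x t z.2 := by
        rw [sum_prod_mul (fun cfg => weight m n p x cfg * g cfg * h (slot cfg t)), hw, mul_one]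
    _ = ∑ z : Cfg m n × Slot m,
          weight m n p x z.1 * g z.1 * (slotWeight p x t z.2 * h z.2) := by
        rw [← Equiv.sum_comp he.toPerm]
        refine Finset.sum_congr rfl fun z _ => ?_
        simp only [Function.Involutive.coe_toPerm, e, hg, slot_updateSlot_self]
        linear_combination g z.1 * h z.2 * weight_updateSlot_mul p x z.1 t z.2
    _ = _ := by
        rw [sum_prod_mul (fun cfg => weight m n p x cfg * g cfg)
          (fun b => slotWeight p x t b * h b)]

/-- The event that bin `i` is unmatched after all balls before time `k` are processed. -/
def freeEvent (x : Fin m → Fin n → ℝ) (i : Fin m) (k : ℕ) : Set (Cfg m n) :=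
  {cfg | FreeBin m n ((proc m n x cfg k).1 ∪ (proc m n x cfg k).2) i}

lemma proc_updateSlot (x : Fin m → Fin n → ℝ) (cfg : Cfg m n) (t : Fin n) (b : Slot m)
    {k : ℕ} (hk : k ≤ t) : proc m n x (updateSlot cfg t b) k = proc m n x cfg k := by
  induction k with
  | zero => rfl
  | succ k ih =>
    have hne : (⟨k, by omega⟩ : Fin n) ≠ t := fun h => by
      have := congrArg Fin.val h
      simp at this
      omega
    simp only [proc, ih (by omega)]
    simp [updateSlot, Function.update_of_ne hne]

lemma mem_proc_fst_iff (x : Fin m → Fin n → ℝ) (cfg : Cfg m n) (i : Fin m) (t : Fin n) (k : ℕ) :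
    (i, t) ∈ (proc m n x cfg k).1 ↔
      t.1 < k ∧ cfg ∈ freeEvent x i t ∧
        (cfg.1 t = true ∧ cfg.2.1 t = i ∧ cfg.2.2.2 i t = true) := by
  induction k with
  | zero => simp [proc]
  | succ k ih =>
    have hlt : t.1 < k + 1 ↔ t.1 < k ∨ t.1 = k := by omega
    rw [hlt]
    by_cases hk : k < n
    · simp only [proc, hk, dite_true]
      by_cases htk : t.1 = k
      · subst htk
        simp only [Fin.eta]
        simp only [lt_irrefl, false_and, iff_false] at ih
        split_ifs with h1 h2
        · simp only [Finset.mem_insert, ih, Prod.mk.injEq, freeEvent, Set.mem_ofPred_eq]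
          grind
        · simp only [ih, freeEvent, Set.mem_ofPred_eq]
          grind
        · simp only [ih, freeEvent, Set.mem_ofPred_eq]
          grind
      · have hne : t ≠ ⟨k, hk⟩ := fun h => htk (congrArg Fin.val h)
        split_ifs with h1 h2 <;> simp [ih, htk, hne]
    · have : t.1 < k := by omega
      simp only [proc, hk, dite_false]
      simp [ih, this]

lemma freeBin_insert (M : Finset (Fin m × Fin n)) (i j : Fin m) (t : Fin n) :
    FreeBin m n (insert (j, t) M) i ↔ FreeBin m n M i ∧ j ≠ i := by
  simp only [FreeBin, Finset.mem_insert, Prod.mk.injEq]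
  grind

lemma mem_freeEvent_succ_iff (x : Fin m → Fin n → ℝ) (cfg : Cfg m n) (i : Fin m) (t : Fin n) :
    cfg ∈ freeEvent x i (t + 1) ↔ cfg ∈ freeEvent x i t ∧
      ¬ (cfg.1 t = true ∧ cfg.2.1 t = i ∧ cfg.2.2.2 i t = true) ∧
      ¬ (Late m n x i t ∧ cfg.1 t = true ∧ cfg.2.2.1 t = i ∧
        ¬ (cfg ∈ freeEvent x (cfg.2.1 t) t ∧ cfg.2.2.2 (cfg.2.1 t) t = true)) := by
  simp only [freeEvent, proc, Set.mem_ofPred_eq, t.2, dite_true, Fin.eta]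
  split_ifs with h1 h2
  · rw [Finset.insert_union, freeBin_insert]
    grind
  · rw [Finset.union_insert, freeBin_insert]
    grind
  · grind

lemma sum_div_eq_one {p : Fin n → ℝ} {x : Fin m → Fin n → ℝ} (hx : LPFeasible m n p x)
    (t : Fin n) : ∑ i, x i t / p t = 1 := by
  rw [← Finset.sum_div, hx.2.2.2.1 t, div_self (hx.1 t).1.ne']

lemma sum_slotWeight {p : Fin n → ℝ} {x : Fin m → Fin n → ℝ} (hx : LPFeasible m n p x)
    (t : Fin n) : ∑ b, slotWeight p x t b = 1 := by
  have := sum_slotWeight_mul p x t (fun _ => 1) (fun _ => 1) (fun _ => 1) (fun _ _ => 1)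
  simpa [sum_div_eq_one hx] using this

lemma sum_slotWeight_firstPick {p : Fin n → ℝ} {x : Fin m → Fin n → ℝ}
    (hx : LPFeasible m n p x) (i : Fin m) (t : Fin n) :
    (∑ b : Slot m, slotWeight p x t b *
      if b.1 = true ∧ b.2.1 = i ∧ b.2.2.2 i = true then 1 else 0) = x i t * q m n x i t := by
  have := sum_slotWeight_mul p x t (fun a => if a then 1 else 0) (fun j => if j = i then 1 else 0)
    (fun _ => 1) (fun j y => if j = i then (if y then 1 else 0) else 1)
  have hp := (hx.1 t).1.ne'
  convert this using 1
  · refine Finset.sum_congr rfl fun b _ => ?_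
    congr 1
    rw [Finset.prod_ite_eq' Finset.univ i (fun j => if b.2.2.2 j = true then (1 : ℝ) else 0)]
    simp only [Finset.mem_univ, if_true]
    split_ifs <;> simp_all
  · have hq : ∀ j, (q m n x j t * (if j = i then (if true = true then 1 else 0) else 1) +
        (1 - q m n x j t) * (if j = i then (if false = true then 1 else 0) else 1)) =
        if j = i then q m n x j t else 1 := fun j => by
      split_ifs <;> simp_all
    rw [Finset.prod_congr rfl fun j _ => hq j,
      Finset.prod_ite_eq' Finset.univ i (fun j => q m n x j t)]
    simp only [sum_div_eq_one hx, mul_ite, mul_one, mul_zero, Finset.sum_ite_eq',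
      Finset.mem_univ, if_true, Bool.false_eq_true, if_false, add_zero]
    field_simp

lemma sum_slotWeight_secondPick {p : Fin n → ℝ} {x : Fin m → Fin n → ℝ}
    (hx : LPFeasible m n p x) (i : Fin m) (t : Fin n) :
    (∑ b : Slot m, slotWeight p x t b * if b.1 = true ∧ b.2.2.1 = i then 1 else 0) = x i t := by
  have := sum_slotWeight_mul p x t (fun a => if a then 1 else 0) (fun _ => 1)
    (fun j => if j = i then 1 else 0) (fun _ _ => 1)
  have hp := (hx.1 t).1.ne'
  convert this using 1
  · refine Finset.sum_congr rfl fun b _ => ?_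
    congr 1
    split_ifs <;> simp_all
  · simp [sum_div_eq_one hx]
    field_simp

/-- The event that ball `t` arrives, first picks `i`, and its coin for `i` comes up heads. -/
def firstPick (i : Fin m) (t : Fin n) : Set (Cfg m n) :=
  {cfg | cfg.1 t = true ∧ cfg.2.1 t = i ∧ cfg.2.2.2 i t = true}

/-- The event that ball `t` arrives and its second pick is `i`. -/
def secondPick (i : Fin m) (t : Fin n) : Set (Cfg m n) :=
  {cfg | cfg.1 t = true ∧ cfg.2.2.1 t = i}

lemma Pr_eq_sum (p : Fin n → ℝ) (x : Fin m → Fin n → ℝ) (E : Set (Cfg m n)) :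
    Pr m n p x E = ∑ cfg, weight m n p x cfg * if cfg ∈ E then 1 else 0 := by
  simp [Pr]

lemma Pr_inter_eq_mul {p : Fin n → ℝ} {x : Fin m → Fin n → ℝ} (hx : LPFeasible m n p x)
    (t : Fin n) {E F : Set (Cfg m n)} (hE : ∀ cfg b, updateSlot cfg t b ∈ E ↔ cfg ∈ E)
    (h : Slot m → ℝ) (hF : ∀ cfg, (if cfg ∈ F then (1 : ℝ) else 0) = h (slot cfg t)) :
    Pr m n p x (E ∩ F) = Pr m n p x E * ∑ b, slotWeight p x t b * h b := by
  rw [Pr_eq_sum, Pr_eq_sum, ← sum_weight_mul_slot p x t (sum_slotWeight hx t) _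
    (fun cfg b => by simp only [hE])]
  refine Finset.sum_congr rfl fun cfg _ => ?_
  rw [← hF, mul_assoc]
  congr 1
  by_cases h1 : cfg ∈ E <;> simp [h1]

lemma updateSlot_mem_freeEvent (x : Fin m → Fin n → ℝ) (i : Fin m) (t : Fin n) (cfg : Cfg m n)
    (b : Slot m) : updateSlot cfg t b ∈ freeEvent x i t ↔ cfg ∈ freeEvent x i t := by
  simp only [freeEvent, Set.mem_ofPred_eq, proc_updateSlot x cfg t b le_rfl]

lemma Pr_freeEvent_inter_firstPick {p : Fin n → ℝ} {x : Fin m → Fin n → ℝ}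
    (hx : LPFeasible m n p x) (i : Fin m) (t : Fin n) :
    Pr m n p x (freeEvent x i t ∩ firstPick i t) =
      Pr m n p x (freeEvent x i t) * (x i t * q m n x i t) := by
  rw [← sum_slotWeight_firstPick hx i t]
  exact Pr_inter_eq_mul hx t (updateSlot_mem_freeEvent x i t) _ fun _ => by
    simp only [firstPick, slot, Set.mem_ofPred_eq]
    congr

lemma Pr_freeEvent_inter_secondPick {p : Fin n → ℝ} {x : Fin m → Fin n → ℝ}
    (hx : LPFeasible m n p x) (i : Fin m) (t : Fin n) :
    Pr m n p x (freeEvent x i t ∩ secondPick i t) = Pr m n p x (freeEvent x i t) * x i t := by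
  refine Eq.trans ?_ (congrArg _ (sum_slotWeight_secondPick hx i t))
  exact Pr_inter_eq_mul hx t (updateSlot_mem_freeEvent x i t) _ fun _ => by
    simp only [secondPick, slot, Set.mem_ofPred_eq]
    congr

lemma setOf_mem_M1F (x : Fin m → Fin n → ℝ) (i : Fin m) (t : Fin n) :
    {cfg | (i, t) ∈ M1F m n x cfg} = freeEvent x i t ∩ firstPick i t := by
  ext cfg
  simp only [M1F, mem_proc_fst_iff, firstPick, Set.mem_inter_iff, Set.mem_ofPred_eq, t.2,
    true_and]

/-- The mass `∑_{t' < k} x i t'`, with `k` a natural number. -/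
def prefixSum (x : Fin m → Fin n → ℝ) (i : Fin m) (k : ℕ) : ℝ :=
  ∑ t' ∈ Finset.univ.filter fun t' : Fin n => t'.1 < k, x i t'

lemma S_eq_prefixSum (x : Fin m → Fin n → ℝ) (i : Fin m) (t : Fin n) :
    S m n x i t = prefixSum x i t := rfl

lemma prefixSum_succ (x : Fin m → Fin n → ℝ) (i : Fin m) (t : Fin n) :
    prefixSum x i (t + 1) = prefixSum x i t + x i t := by
  have : (Finset.univ.filter fun t' : Fin n => t'.1 < t.1 + 1) =
      insert t (Finset.univ.filter fun t' : Fin n => t'.1 < t.1) := by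
    ext s
    simp only [Finset.mem_filter, Finset.mem_univ, true_and, Finset.mem_insert, Fin.ext_iff]
    omega
  rw [prefixSum, this, Finset.sum_insert (by simp), prefixSum, add_comm]

lemma prefixSum_le_one {p : Fin n → ℝ} {x : Fin m → Fin n → ℝ} (hx : LPFeasible m n p x)
    (i : Fin m) (k : ℕ) : prefixSum x i k ≤ 1 :=
  (Finset.sum_le_sum_of_subset_of_nonneg (Finset.filter_subset _ _)
    fun t _ _ => hx.2.1 i t).trans (hx.2.2.1 i)

lemma early_iff (x : Fin m → Fin n → ℝ) (i : Fin m) (t : Fin n) :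
    Early m n x i t ↔ prefixSum x i t ≤ 49 / 51 := by
  rw [Early, S_eq_prefixSum, c]
  norm_num

lemma q_of_early {x : Fin m → Fin n → ℝ} {i : Fin m} {t : Fin n}
    (h : prefixSum x i t ≤ 49 / 51) :
    q m n x i t * (1 - 51 / 100 * prefixSum x i t) = 51 / 100 := by
  have hpos : 0 < 1 - 51 / 100 * prefixSum x i t := by linarith
  have hc : (1 / 2 + c : ℝ) = 51 / 100 := by norm_num [c]
  rw [q, S_eq_prefixSum, hc, min_eq_right ((div_le_one hpos).2 (by linarith)),
    div_mul_cancel₀ _ hpos.ne']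

lemma q_of_late {p : Fin n → ℝ} {x : Fin m → Fin n → ℝ} (hx : LPFeasible m n p x)
    {i : Fin m} {t : Fin n} (h : 49 / 51 < prefixSum x i t) : q m n x i t = 1 := by
  have hpos : 0 < 1 - 51 / 100 * prefixSum x i t := by linarith [prefixSum_le_one hx i t]
  have hc : (1 / 2 + c : ℝ) = 51 / 100 := by norm_num [c]
  rw [q, S_eq_prefixSum, hc, min_eq_left ((one_le_div hpos).2 (by linarith))]

lemma weight_nonneg {p : Fin n → ℝ} {x : Fin m → Fin n → ℝ} (hx : LPFeasible m n p x)
    (cfg : Cfg m n) : 0 ≤ weight m n p x cfg := by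
  have hq0 : ∀ i t, 0 ≤ q m n x i t := fun i t => by
    have := prefixSum_le_one hx i t
    rw [q, S_eq_prefixSum]
    refine le_min zero_le_one (div_nonneg ?_ ?_) <;> norm_num [c]
    linarith
  have hq1 : ∀ i t, q m n x i t ≤ 1 := fun i t => min_le_left _ _
  have hd : ∀ j t, 0 ≤ x j t / p t := fun j t => div_nonneg (hx.2.1 j t) (hx.1 t).1.le
  rw [weight]
  refine mul_nonneg (mul_nonneg (mul_nonneg ?_ ?_) ?_) ?_
  · exact Finset.prod_nonneg fun t _ => by
      split_ifs <;> linarith [(hx.1 t).1, (hx.1 t).2]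
  · exact Finset.prod_nonneg fun t _ => hd _ t
  · exact Finset.prod_nonneg fun t _ => hd _ t
  · exact Finset.prod_nonneg fun i _ => Finset.prod_nonneg fun t _ => by
      split_ifs <;> linarith [hq0 i t, hq1 i t]

lemma Pr_univ {p : Fin n → ℝ} {x : Fin m → Fin n → ℝ} (hx : LPFeasible m n p x) :
    Pr m n p x Set.univ = 1 := by
  have hA : ∑ a : Fin n → Bool, ∏ t, (if a t then p t else 1 - p t) = 1 := by
    have := Finset.prod_univ_sum (fun _ : Fin n => (Finset.univ : Finset Bool))
      (fun t b => if b then p t else 1 - p t)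
    rw [Fintype.piFinset_univ] at this
    rw [← this]
    simp
  have hI : ∑ f : Fin n → Fin m, ∏ t, x (f t) t / p t = 1 := by
    have := Finset.prod_univ_sum (fun _ : Fin n => (Finset.univ : Finset (Fin m)))
      (fun t j => x j t / p t)
    rw [Fintype.piFinset_univ] at this
    rw [← this]
    simp [sum_div_eq_one hx]
  have hY : ∑ y : Fin m → Fin n → Bool,
      ∏ i, ∏ t, (if y i t then q m n x i t else 1 - q m n x i t) = 1 := by
    have h2 := Finset.prod_univ_sum (fun _ : Fin m => (Finset.univ : Finset (Fin n → Bool)))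
      (fun i z => ∏ t, if z t then q m n x i t else 1 - q m n x i t)
    rw [Fintype.piFinset_univ] at h2
    rw [← h2]
    refine Finset.prod_eq_one fun i _ => ?_
    have := Finset.prod_univ_sum (fun _ : Fin n => (Finset.univ : Finset Bool))
      (fun t b => if b then q m n x i t else 1 - q m n x i t)
    rw [Fintype.piFinset_univ] at this
    rw [← this]
    simp
  simp only [Pr, Set.mem_univ, if_true, weight]
  rw [sum_prod_mul_four (fun a : Fin n → Bool => ∏ t, if a t then p t else 1 - p t)
    (fun f : Fin n → Fin m => ∏ t, x (f t) t / p t) (fun f : Fin n → Fin m => ∏ t, x (f t) t / p t)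
    (fun y : Fin m → Fin n → Bool =>
      ∏ i, ∏ t, if y i t then q m n x i t else 1 - q m n x i t), hA, hI, hY]
  norm_num

lemma Pr_freeEvent_succ_of_early {p : Fin n → ℝ} {x : Fin m → Fin n → ℝ} {i : Fin m} {t : Fin n}
    (h : Early m n x i t) :
    Pr m n p x (freeEvent x i (t + 1)) =
      Pr m n p x (freeEvent x i t) - Pr m n p x (freeEvent x i t ∩ firstPick i t) := by
  simp only [Pr]
  rw [← Finset.sum_sub_distrib]
  refine Finset.sum_congr rfl fun cfg _ => ?_
  have hiff := mem_freeEvent_succ_iff x cfg i t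
  simp only [Late, h, not_true, false_and, not_false_iff, and_true] at hiff
  simp only [hiff, Set.mem_inter_iff, firstPick, Set.mem_ofPred_eq]
  split_ifs <;> simp_all

lemma Pr_freeEvent_succ_le {p : Fin n → ℝ} {x : Fin m → Fin n → ℝ} (hx : LPFeasible m n p x)
    (i : Fin m) (t : Fin n) :
    Pr m n p x (freeEvent x i (t + 1)) ≤ Pr m n p x (freeEvent x i t) := by
  refine Finset.sum_le_sum fun cfg _ => ?_
  have hw := weight_nonneg hx cfg
  have hiff := mem_freeEvent_succ_iff x cfg i t
  split_ifs <;> simp_all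

lemma Pr_freeEvent_le_succ_add {p : Fin n → ℝ} {x : Fin m → Fin n → ℝ} (hx : LPFeasible m n p x)
    (i : Fin m) (t : Fin n) :
    Pr m n p x (freeEvent x i t) ≤ Pr m n p x (freeEvent x i (t + 1)) +
      Pr m n p x (freeEvent x i t ∩ firstPick i t) +
      Pr m n p x (freeEvent x i t ∩ secondPick i t) := by
  simp only [Pr]
  rw [← Finset.sum_add_distrib, ← Finset.sum_add_distrib]
  refine Finset.sum_le_sum fun cfg _ => ?_
  have hw := weight_nonneg hx cfg
  by_cases h0 : cfg ∈ freeEvent x i t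
  · by_cases h1 : cfg ∈ firstPick i t
    · simp only [h0, h1, Set.mem_inter_iff, and_self, if_true]
      split_ifs <;> linarith
    by_cases h2 : cfg ∈ secondPick i t
    · simp only [h0, h1, h2, Set.mem_inter_iff, and_self, if_true]
      split_ifs <;> linarith
    have h3 : cfg ∈ freeEvent x i (t + 1) := by
      rw [mem_freeEvent_succ_iff]
      exact ⟨h0, h1, fun h => h2 ⟨h.2.1, h.2.2.1⟩⟩
    simp [h0, h1, h2, h3]
  · simp only [h0, Set.mem_inter_iff, false_and, if_false]
    split_ifs <;> linarith

/-- The probability that bin `i` is still unmatched is determined by the mass seen so far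
up to the early threshold, and stays within a constant window afterwards. -/
lemma Pr_freeEvent_bounds {p : Fin n → ℝ} {x : Fin m → Fin n → ℝ} (hx : LPFeasible m n p x)
    (i : Fin m) {k : ℕ} (hk : k ≤ n) :
    (prefixSum x i k ≤ 49 / 51 →
      Pr m n p x (freeEvent x i k) = 1 - 51 / 100 * prefixSum x i k) ∧
    (49 / 51 < prefixSum x i k →
      149 / 100 - 102 / 100 * prefixSum x i k ≤ Pr m n p x (freeEvent x i k) ∧
      Pr m n p x (freeEvent x i k) ≤ 51 / 100) := by
  induction k with
  | zero =>
    have h0 : prefixSum x i 0 = 0 := by simp [prefixSum]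
    have h1 : freeEvent x i 0 = (Set.univ : Set (Cfg m n)) := by
      ext cfg
      simp [freeEvent, proc, FreeBin]
    rw [h0, h1, Pr_univ hx]
    norm_num
  | succ k ih =>
    obtain ⟨ihE, ihL⟩ := ih (by omega)
    lift k to Fin n using hk with t
    have hs := prefixSum_succ x i t
    have hx0 := hx.2.1 i t
    rcases le_or_gt (prefixSum x i t) (49 / 51) with h | h
    · have hF : Pr m n p x (freeEvent x i (t + 1)) = 1 - 51 / 100 * prefixSum x i (t + 1) := by
        rw [Pr_freeEvent_succ_of_early ((early_iff x i t).2 h),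
          Pr_freeEvent_inter_firstPick hx, ihE h, hs]
        linear_combination (-x i t) * q_of_early h
      refine ⟨fun _ => hF, fun h' => ?_⟩
      constructor <;> linarith
    · obtain ⟨hlo, hhi⟩ := ihL h
      have h1 := Pr_freeEvent_succ_le hx i t
      have h2 := Pr_freeEvent_le_succ_add hx i t
      rw [Pr_freeEvent_inter_firstPick hx, Pr_freeEvent_inter_secondPick hx, q_of_late hx h] at h2
      refine ⟨fun h' => by linarith, fun _ => ⟨?_, by linarith⟩⟩
      nlinarith [mul_le_mul_of_nonneg_right hhi hx0]

end

/-- in the rounding process with LP-feasible `x`, every early edge `(i,t)`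
satisfies `P[(i,t) ∈ M₁] = x_{i,t}·(1/2 + c)`, and every edge `(i,t)` satisfies
`x_{i,t}·(1/2 − 3c) ≤ P[(i,t) ∈ M₁] ≤ x_{i,t}·(1/2 + c)`. -/
theorem first_pick_marginals (p : Fin n → ℝ) (x : Fin m → Fin n → ℝ)
    (hx : LPFeasible m n p x) (i : Fin m) (t : Fin n) :
    (Early m n x i t → Pr m n p x {cfg | (i, t) ∈ M1F m n x cfg} = x i t * (1/2 + c)) ∧
    x i t * (1/2 - 3 * c) ≤ Pr m n p x {cfg | (i, t) ∈ M1F m n x cfg} ∧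
    Pr m n p x {cfg | (i, t) ∈ M1F m n x cfg} ≤ x i t * (1/2 + c) := by
  rw [setOf_mem_M1F, Pr_freeEvent_inter_firstPick hx]
  obtain ⟨hE, hL⟩ := Pr_freeEvent_bounds hx i t.2.le
  have hx0 := hx.2.1 i t
  have hc : c = 1 / 100 := rfl
  rcases le_or_gt (prefixSum x i t) (49 / 51) with h | h
  · have heq : Pr m n p x (freeEvent x i t) * (x i t * q m n x i t) = x i t * (1/2 + c) := by
      rw [hE h, hc]
      linear_combination x i t * q_of_early h
    rw [heq, hc]
    exact ⟨fun _ => rfl, by linarith, le_rfl⟩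
  · obtain ⟨hlo, hhi⟩ := hL h
    have h1 := prefixSum_le_one hx i t
    rw [q_of_late hx h, mul_one, mul_comm, hc]
    refine ⟨fun he => absurd ((early_iff x i t).1 he) (not_le.2 h), ?_, ?_⟩ <;>
      exact mul_le_mul_of_nonneg_left (by linarith) hx0

end Rounding
end
end

section
/- In the rounding process with LP-feasible x, for every fixed time t, the family of indicator random variables {1_{O^E_{i,t}}}_{i ∈ {1,…,m}} is negatively associated. -/
open Finset

noncomputable section
open scoped Classical

namespace Rounding

variable (m n : ℕ)

/-- A family `X` of real random variables on the finite discrete probability space with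
probability mass function `w` is *negatively associated* if for all disjoint index sets
`I, J` and all (automatically bounded and measurable) coordinatewise non-decreasing
functions `f`, `g` depending only on the coordinates in `I` resp. `J`, we have
`E[f(X)·g(X)] ≤ E[f(X)]·E[g(X)]`. -/
def NegAssocW {Ω ι : Type*} [Fintype Ω] (w : Ω → ℝ) (X : ι → Ω → ℝ) : Prop :=
  ∀ I J : Set ι, Disjoint I J →
    ∀ f g : (ι → ℝ) → ℝ, Monotone f → Monotone g →
      (∀ v v', (∀ k ∈ I, v k = v' k) → f v = f v') →
      (∀ v v', (∀ k ∈ J, v k = v' k) → g v = g v') →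
      ∑ ω, w ω * (f (fun k => X k ω) * g (fun k => X k ω)) ≤
        (∑ ω, w ω * f (fun k => X k ω)) * ∑ ω, w ω * g (fun k => X k ω)

section OneHot

variable {ι α : Type*}

/-- Adding a random set with at most one element to a fixed set `B` can only make functions of
disjoint sets of coordinates negatively correlated. -/
lemma sum_mul_union_subsingleton_le [Fintype α] {w : α → ℝ} (hw : ∀ a, 0 ≤ w a)
    (hw1 : ∑ a, w a = 1) {h : α → Set ι} (hh : ∀ a, (h a).Subsingleton) {I J : Set ι}
    (hIJ : Disjoint I J) {F G : Set ι → ℝ} (hF : Monotone F) (hG : Monotone G)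
    (hFI : ∀ B B' : Set ι, (∀ k ∈ I, k ∈ B ↔ k ∈ B') → F B = F B')
    (hGJ : ∀ B B' : Set ι, (∀ k ∈ J, k ∈ B ↔ k ∈ B') → G B = G B') (B : Set ι) :
    ∑ a, w a * (F (h a ∪ B) * G (h a ∪ B)) ≤
      (∑ a, w a * F (h a ∪ B)) * ∑ a, w a * G (h a ∪ B) := by
  have key : ∀ a, (F (h a ∪ B) - F B) * (G (h a ∪ B) - G B) = 0 := by
    intro a
    by_cases hI : ∃ k ∈ I, k ∈ h a
    · obtain ⟨k, hkI, hka⟩ := hI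
      have : G (h a ∪ B) = G B := hGJ _ _ fun l hl => by
        refine ⟨fun h' => h'.resolve_left fun hla => ?_, Or.inr⟩
        exact Set.disjoint_left.mp hIJ hkI (hh a hla hka ▸ hl)
      rw [this, sub_self, mul_zero]
    · have : F (h a ∪ B) = F B := hFI _ _ fun l hl =>
        ⟨fun h' => h'.resolve_left fun hla => hI ⟨l, hl, hla⟩, Or.inr⟩
      rw [this, sub_self, zero_mul]
  have hsum : ∀ H : Set ι → ℝ,
      ∑ a, w a * H (h a ∪ B) = H B + ∑ a, w a * (H (h a ∪ B) - H B) := by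
    intro H
    simp only [mul_sub, Finset.sum_sub_distrib, ← Finset.sum_mul, hw1]
    ring
  have hnonneg : ∀ {H : Set ι → ℝ}, Monotone H → 0 ≤ ∑ a, w a * (H (h a ∪ B) - H B) :=
    fun hH => Finset.sum_nonneg fun a _ =>
      mul_nonneg (hw a) (sub_nonneg.mpr (hH Set.subset_union_right))
  have hprod : ∑ a, w a * (F (h a ∪ B) * G (h a ∪ B)) =
      F B * G B + (F B * ∑ a, w a * (G (h a ∪ B) - G B)
        + G B * ∑ a, w a * (F (h a ∪ B) - F B)) := by
    have hone : F B * G B = ∑ a, w a * (F B * G B) := by rw [← Finset.sum_mul, hw1, one_mul]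
    rw [hone, Finset.mul_sum, Finset.mul_sum, ← Finset.sum_add_distrib,
      ← Finset.sum_add_distrib]
    refine Finset.sum_congr rfl fun a _ => ?_
    linear_combination w a * key a
  rw [hprod, hsum F, hsum G]
  nlinarith [mul_nonneg (hnonneg hF) (hnonneg hG)]

lemma sum_pi_succ [Fintype α] {N : ℕ} (w : Fin (N + 1) → α → ℝ) (h : Fin (N + 1) → α → Set ι)
    (H : Set ι → ℝ) :
    ∑ ω : Fin (N + 1) → α, (∏ s, w s (ω s)) * H (⋃ s, h s (ω s)) =
      ∑ ω : Fin N → α, (∏ s, w s.succ (ω s)) *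
        ∑ a, w 0 a * H (h 0 a ∪ ⋃ s, h s.succ (ω s)) := by
  rw [← (Fin.consEquiv fun _ => α).sum_comp, Fintype.sum_prod_type, Finset.sum_comm]
  refine Finset.sum_congr rfl fun ω _ => ?_
  rw [Finset.mul_sum]
  refine Finset.sum_congr rfl fun a _ => ?_
  have hU : (⋃ s, h s ((Fin.cons a ω : Fin (N + 1) → α) s)) =
      h 0 a ∪ ⋃ s, h s.succ (ω s) := by
    ext k
    simp [Fin.exists_fin_succ]
  simp only [Fin.consEquiv_apply, hU, Fin.prod_univ_succ, Fin.cons_zero, Fin.cons_succ]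
  ring

/-- Monotone functions of disjoint sets of coordinates of a union of independent random sets,
each with at most one element, are negatively correlated. -/
theorem sum_mul_iUnion_subsingleton_le [Fintype α] {I J : Set ι} (hIJ : Disjoint I J) {N : ℕ}
    {w : Fin N → α → ℝ} (hw : ∀ s a, 0 ≤ w s a) (hw1 : ∀ s, ∑ a, w s a = 1)
    {h : Fin N → α → Set ι} (hh : ∀ s a, (h s a).Subsingleton)
    {F G : Set ι → ℝ} (hF : Monotone F) (hG : Monotone G)
    (hFI : ∀ B B' : Set ι, (∀ k ∈ I, k ∈ B ↔ k ∈ B') → F B = F B')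
    (hGJ : ∀ B B' : Set ι, (∀ k ∈ J, k ∈ B ↔ k ∈ B') → G B = G B') :
    ∑ ω : Fin N → α, (∏ s, w s (ω s)) * (F (⋃ s, h s (ω s)) * G (⋃ s, h s (ω s))) ≤
      (∑ ω : Fin N → α, (∏ s, w s (ω s)) * F (⋃ s, h s (ω s))) *
        ∑ ω : Fin N → α, (∏ s, w s (ω s)) * G (⋃ s, h s (ω s)) := by
  induction N generalizing F G with
  | zero => simp
  | succ N ih =>
    have hmono : ∀ {H : Set ι → ℝ}, Monotone H →
        Monotone fun B => ∑ a, w 0 a * H (h 0 a ∪ B) := fun hH B B' hB =>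
      Finset.sum_le_sum fun a _ =>
        mul_le_mul_of_nonneg_left (hH (Set.union_subset_union_right _ hB)) (hw 0 a)
    have hloc : ∀ {H : Set ι → ℝ} {K : Set ι},
        (∀ B B' : Set ι, (∀ k ∈ K, k ∈ B ↔ k ∈ B') → H B = H B') →
        ∀ B B' : Set ι, (∀ k ∈ K, k ∈ B ↔ k ∈ B') →
          ∑ a, w 0 a * H (h 0 a ∪ B) = ∑ a, w 0 a * H (h 0 a ∪ B') := fun hH B B' hB =>
      Finset.sum_congr rfl fun a _ => by
        rw [hH (h 0 a ∪ B) (h 0 a ∪ B') fun k hk => or_congr_right (hB k hk)]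
    rw [sum_pi_succ w h fun B => F B * G B, sum_pi_succ w h F, sum_pi_succ w h G]
    refine le_trans (Finset.sum_le_sum fun ω _ => mul_le_mul_of_nonneg_left
      (sum_mul_union_subsingleton_le (hw 0) (hw1 0) (hh 0) hIJ hF hG hFI hGJ _)
      (Finset.prod_nonneg fun s _ => hw _ _)) ?_
    exact ih (fun s => hw s.succ) (fun s => hw1 s.succ) (fun s => hh s.succ)
      (hmono hF) (hmono hG) (hloc hFI) (hloc hGJ)

end OneHot

variable {m n}

/-- The randomness attached to one ball: arrival, the two picks and the acceptance coins. -/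
abbrev BallCfg (m : ℕ) := Bool × Fin m × Fin m × (Fin m → Bool)

/-- A configuration is a choice of the randomness of each ball. -/
def ballEquiv (m n : ℕ) : (Fin n → BallCfg m) ≃ Cfg m n where
  toFun ω := (fun s => (ω s).1, fun s => (ω s).2.1, fun s => (ω s).2.2.1,
    fun i s => (ω s).2.2.2 i)
  invFun cfg s := (cfg.1 s, cfg.2.1 s, cfg.2.2.1 s, fun i => cfg.2.2.2 i s)
  left_inv _ := rfl
  right_inv _ := rfl

/-- The probability of the randomness of ball `s`. -/
def ballWeight (p : Fin n → ℝ) (x : Fin m → Fin n → ℝ) (s : Fin n) (a : BallCfg m) : ℝ :=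
  (if a.1 then p s else 1 - p s) * (x a.2.1 s / p s) * (x a.2.2.1 s / p s) *
    ∏ i, if a.2.2.2 i then q m n x i s else 1 - q m n x i s

lemma weight_ballEquiv (p : Fin n → ℝ) (x : Fin m → Fin n → ℝ) (ω : Fin n → BallCfg m) :
    weight m n p x (ballEquiv m n ω) = ∏ s, ballWeight p x s (ω s) := by
  simp only [weight, ballEquiv, ballWeight, Equiv.coe_fn_mk, Finset.prod_mul_distrib]
  congr 1
  exact Finset.prod_comm

lemma S_le_one {x : Fin m → Fin n → ℝ} (h0 : ∀ i s, 0 ≤ x i s) (h1 : ∀ i, ∑ s, x i s ≤ 1)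
    (i : Fin m) (s : Fin n) : S m n x i s ≤ 1 :=
  (Finset.sum_le_univ_sum_of_nonneg (h0 i)).trans (h1 i)

lemma q_nonneg {x : Fin m → Fin n → ℝ} (h0 : ∀ i s, 0 ≤ x i s) (h1 : ∀ i, ∑ s, x i s ≤ 1)
    (i : Fin m) (s : Fin n) : 0 ≤ q m n x i s := by
  have := S_le_one h0 h1 i s
  refine le_min zero_le_one (div_nonneg ?_ ?_) <;> unfold c <;> linarith

lemma ballWeight_nonneg {p : Fin n → ℝ} {x : Fin m → Fin n → ℝ} (hx : LPFeasible m n p x)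
    (s : Fin n) (a : BallCfg m) : 0 ≤ ballWeight p x s a := by
  obtain ⟨hp, h0, h1, -, -⟩ := hx
  have hdiv : ∀ i, 0 ≤ x i s / p s := fun i => div_nonneg (h0 i s) (hp s).1.le
  refine mul_nonneg (mul_nonneg (mul_nonneg ?_ (hdiv _)) (hdiv _))
    (Finset.prod_nonneg fun i _ => ?_)
  · split_ifs
    · exact (hp s).1.le
    · exact sub_nonneg.mpr (hp s).2
  · split_ifs
    · exact q_nonneg h0 h1 i s
    · exact sub_nonneg.mpr (min_le_left _ _)

lemma sum_ballWeight {p : Fin n → ℝ} {x : Fin m → Fin n → ℝ} (hx : LPFeasible m n p x)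
    (s : Fin n) : ∑ a, ballWeight p x s a = 1 := by
  obtain ⟨hp, -, -, hsum, -⟩ := hx
  have hpick : ∑ i, x i s / p s = 1 := by
    rw [← Finset.sum_div, hsum, div_self (hp s).1.ne']
  have hcoin : ∑ y : Fin m → Bool, ∏ i, (if y i then q m n x i s else 1 - q m n x i s) = 1 := by
    rw [← Fintype.prod_sum fun i (b : Bool) => if b then q m n x i s else 1 - q m n x i s]
    simp
  simp only [Fintype.sum_prod_type]
  change ∑ b : Bool, ∑ i, ∑ j, ∑ y : Fin m → Bool,
    (if b then p s else 1 - p s) * (x i s / p s) * (x j s / p s) *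
      ∏ k, (if y k then q m n x k s else 1 - q m n x k s) = 1
  simp only [← Finset.mul_sum, hcoin, hpick, mul_one]
  simp

lemma S_mono {x : Fin m → Fin n → ℝ} (h0 : ∀ i s, 0 ≤ x i s) (i : Fin m) :
    Monotone (S m n x i) := fun s s' hs =>
  Finset.sum_le_sum_of_subset_of_nonneg
    (fun r hr => by simp only [Finset.mem_filter] at hr ⊢; exact ⟨hr.1, hr.2.trans_le hs⟩)
    fun r _ _ => h0 i r

/-- The first pick of ball `s` is `i`, and it is accepted if bin `i` is free. -/
def Proposes (cfg : Cfg m n) (i : Fin m) (s : Fin n) : Prop :=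
  cfg.1 s = true ∧ cfg.2.1 s = i ∧ cfg.2.2.2 i s = true

lemma mem_proc (x : Fin m → Fin n → ℝ) (cfg : Cfg m n) (i : Fin m) (s : Fin n) (k : ℕ) :
    ((i, s) ∈ (proc m n x cfg k).1 → s.1 < k ∧ Proposes cfg i s) ∧
      ((i, s) ∈ (proc m n x cfg k).2 → s.1 < k ∧ Late m n x i s) := by
  induction k with
  | zero => simp [proc]
  | succ k ih =>
    have ih1 := fun h => (⟨(ih.1 h).1.trans k.lt_succ_self, (ih.1 h).2⟩ : _ ∧ _)
    have ih2 := fun h => (⟨(ih.2 h).1.trans k.lt_succ_self, (ih.2 h).2⟩ : _ ∧ _)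
    simp only [proc]
    split_ifs with h hc hc'
    · refine ⟨fun hm => ?_, ih2⟩
      rcases Finset.mem_insert.mp hm with he | hm
      · obtain ⟨rfl, rfl⟩ := Prod.mk.inj he
        exact ⟨k.lt_succ_self, hc.1, rfl, hc.2.2⟩
      · exact ih1 hm
    · refine ⟨ih1, fun hm => ?_⟩
      rcases Finset.mem_insert.mp hm with he | hm
      · obtain ⟨rfl, rfl⟩ := Prod.mk.inj he
        exact ⟨k.lt_succ_self, hc'.2.2⟩
      · exact ih2 hm
    · exact ⟨ih1, ih2⟩
    · exact ⟨ih1, ih2⟩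

lemma proc_union_mono (x : Fin m → Fin n → ℝ) (cfg : Cfg m n) :
    Monotone fun k => (proc m n x cfg k).1 ∪ (proc m n x cfg k).2 := by
  refine monotone_nat_of_le_succ fun k => ?_
  simp only [proc]
  split_ifs
  · exact Finset.union_subset_union_left (Finset.subset_insert _ _)
  · exact Finset.union_subset_union_right (Finset.subset_insert _ _)
  · exact le_rfl
  · exact le_rfl

lemma Proposes.exists_mem {cfg : Cfg m n} {i : Fin m} {s : Fin n} (h : Proposes cfg i s)
    (x : Fin m → Fin n → ℝ) :
    ∃ r, (i, r) ∈ (proc m n x cfg (s.1 + 1)).1 ∪ (proc m n x cfg (s.1 + 1)).2 := by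
  obtain ⟨hA, rfl, hY⟩ := h
  by_cases hfree : FreeBin m n ((proc m n x cfg s.1).1 ∪ (proc m n x cfg s.1).2) (cfg.2.1 s)
  · refine ⟨s, Finset.mem_union_left _ ?_⟩
    simp only [proc]
    rw [dif_pos s.2, if_pos ⟨hA, hfree, hY⟩]
    exact Finset.mem_insert_self _ _
  · obtain ⟨r, hr⟩ := not_forall_not.mp hfree
    exact ⟨r, proc_union_mono x cfg s.1.le_succ hr⟩

/-- A bin is matched early before time `t` iff some early ball before `t` proposes to it. -/
lemma mem_OE_iff {x : Fin m → Fin n → ℝ} (h0 : ∀ i s, 0 ≤ x i s) (cfg : Cfg m n) (i : Fin m)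
    (t : Fin n) :
    cfg ∈ OE m n x i t ↔ ∃ s, s < t ∧ Early m n x i s ∧ Proposes cfg i s := by
  constructor
  · rintro ⟨s, hs, hm⟩
    rcases Finset.mem_union.mp hm with hm | hm
    · have := (mem_proc x cfg i s t).1 hm
      exact ⟨s, this.1, hs, this.2⟩
    · exact absurd hs ((mem_proc x cfg i s t).2 hm).2
  · rintro ⟨s, hst, hs, hprop⟩
    obtain ⟨r, hr⟩ := hprop.exists_mem x
    have hrs : r.1 < s.1 + 1 := by
      rcases Finset.mem_union.mp hr with hr' | hr'
      · exact ((mem_proc x cfg i r _).1 hr').1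
      · exact ((mem_proc x cfg i r _).2 hr').1
    exact ⟨r, (S_mono h0 i (Fin.le_def.mpr (Nat.le_of_lt_succ hrs))).trans hs,
      proc_union_mono x cfg (Nat.succ_le_of_lt hst) hr⟩

variable (m n)

/-- in the rounding process with LP-feasible `x`, for every fixed time
`t`, the family of indicators `(1_{O^E_{i,t}})_{i}` is negatively associated. -/
theorem OE_indicators_negAssoc (p : Fin n → ℝ) (x : Fin m → Fin n → ℝ)
    (hx : LPFeasible m n p x) (t : Fin n) :
    NegAssocW (weight m n p x)
      (fun (i : Fin m) (cfg : Cfg m n) =>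
        if cfg ∈ OE m n x i t then (1 : ℝ) else 0) := by
  intro I J hIJ f g hf hg hfI hgJ
  let h : Fin n → BallCfg m → Set (Fin m) := fun s a =>
    {i | s < t ∧ Early m n x i s ∧ a.1 = true ∧ a.2.1 = i ∧ a.2.2.2 i = true}
  let ind : Set (Fin m) → Fin m → ℝ := fun B k => if k ∈ B then 1 else 0
  have hind : Monotone ind := by
    intro B B' hB k
    by_cases hk : k ∈ B
    · simp [ind, hk, hB hk]
    · by_cases hk' : k ∈ B' <;> simp [ind, hk, hk']
  have hloc : ∀ {φ : (Fin m → ℝ) → ℝ} {K : Set (Fin m)},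
      (∀ v v', (∀ k ∈ K, v k = v' k) → φ v = φ v') →
      ∀ B B' : Set (Fin m), (∀ k ∈ K, k ∈ B ↔ k ∈ B') → φ (ind B) = φ (ind B') :=
    fun hφ B B' hB => hφ _ _ fun k hk => by simp only [ind, hB k hk]
  have hX : ∀ ω : Fin n → BallCfg m,
      (fun i => if ballEquiv m n ω ∈ OE m n x i t then (1 : ℝ) else 0) =
        ind (⋃ s, h s (ω s)) := by
    intro ω
    funext i
    simp only [ind, mem_OE_iff hx.2.1, Set.mem_iUnion]
    congr 1
  simp only [← (ballEquiv m n).sum_comp, weight_ballEquiv, hX]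
  exact sum_mul_iUnion_subsingleton_le hIJ (ballWeight_nonneg hx) (sum_ballWeight hx)
    (fun s a i hi j hj => hi.2.2.2.1.symm.trans hj.2.2.2.1)
    (F := fun B => f (ind B)) (G := fun B => g (ind B))
    (hf.comp hind) (hg.comp hind) (hloc hfI) (hloc hgJ)

end Rounding
end
end
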